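/- (Sharpness of Beurling's bound) For 0 < a < 1 define B_a(z) = log(1/(1 − a z)) / √(log(1/(1 − a²))), holomorphic on the unit disc. Then B_a(0) = 0, ∬_{|z|<1} |B_a′(z)|² dx dy ≤ π, and for every α > 1, ∫_0^{2π} exp(α |B_a(e^{iθ})|²) dθ → ∞ as a → 1⁻. -/

import Mathlib

open MeasureTheory Real Set Metric Filter
open scoped ENNReal

noncomputable section

/-- The Beurling function B_a(z) = log(1/(1−az)) / √(log(1/(1−a²))) on the unit disc. -/
noncomputable def beurlingFun (a : ℝ) (z : ℂ) : ℂ :=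
  Complex.log (1 / (1 - (a : ℂ) * z)) / (Real.sqrt (Real.log (1 / (1 - a ^ 2))) : ℂ)

theorem re_pos_aux {a : ℝ} (ha : a ∈ Ioo (0:ℝ) 1) {z : ℂ} (hz : ‖z‖ ≤ 1) :
    0 < (1 - (a:ℂ) * z).re := by
  have h1 : z.re ≤ 1 := (Complex.re_le_norm z).trans hz
  obtain ⟨h0, h2⟩ := ha
  simp
  nlinarith

theorem slit_aux {a : ℝ} (ha : a ∈ Ioo (0:ℝ) 1) {z : ℂ} (hz : ‖z‖ ≤ 1) :
    1 / (1 - (a:ℂ) * z) ∈ Complex.slitPlane := by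
  have h := re_pos_aux ha hz
  left
  rw [one_div, Complex.inv_re]
  apply div_pos h
  rw [Complex.normSq_pos]
  intro h0
  rw [h0] at h
  simp at h

theorem ne_aux {a : ℝ} (ha : a ∈ Ioo (0:ℝ) 1) {z : ℂ} (hz : ‖z‖ ≤ 1) :
    (1 - (a:ℂ) * z) ≠ 0 := by
  intro h0
  have h := re_pos_aux ha hz
  rw [h0] at h
  simp at h

theorem L_pos {a : ℝ} (ha : a ∈ Ioo (0:ℝ) 1) : 0 < Real.log (1 / (1 - a ^ 2)) := by
  obtain ⟨h0, h2⟩ := ha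
  apply Real.log_pos
  rw [lt_div_iff₀ (by nlinarith)]
  nlinarith

theorem cont_aux {a : ℝ} (ha : a ∈ Ioo (0:ℝ) 1) (α : ℝ) :
    Continuous (fun θ : ℝ => Real.exp (α * ‖beurlingFun a (Complex.exp (θ * Complex.I))‖ ^ 2)) := by
  have hn : ∀ θ : ℝ, ‖Complex.exp (θ * Complex.I)‖ ≤ 1 := fun θ => by
    rw [Complex.norm_exp_ofReal_mul_I]
  have h1 : Continuous (fun θ : ℝ => 1 / (1 - (a:ℂ) * Complex.exp (θ * Complex.I))) := by
    apply Continuous.div continuous_const (by fun_prop)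
    intro θ
    exact ne_aux ha (hn θ)
  have h2 : Continuous (fun θ : ℝ => Complex.log (1 / (1 - (a:ℂ) * Complex.exp (θ * Complex.I)))) :=
    h1.clog (fun θ => slit_aux ha (hn θ))
  unfold beurlingFun
  have := h2.div_const (Real.sqrt (Real.log (1 / (1 - a ^ 2))) : ℂ)
  fun_prop

theorem pt_bound {a : ℝ} (ha : a ∈ Ioo (1/2:ℝ) 1) {θ : ℝ} (hθ : θ ∈ Icc 0 (1 - a)) :
    -Real.log (1 - a) - 2 * Real.log 2 ≤ ‖beurlingFun a (Complex.exp (θ * Complex.I))‖ ^ 2 := by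
  obtain ⟨h0, h2⟩ := ha
  have ha' : a ∈ Ioo (0:ℝ) 1 := ⟨by linarith, h2⟩
  have hL := L_pos ha'
  set L := Real.log (1 / (1 - a ^ 2)) with hLdef
  set t := -Real.log (1 - a) with ht
  have hLt : L ≤ t := by
    rw [hLdef, ht, one_div, Real.log_inv]
    apply neg_le_neg
    apply Real.log_le_log <;> nlinarith
  have hl2 : 0 < Real.log 2 := Real.log_pos (by norm_num)
  have ht2 : Real.log 2 ≤ t := by
    rw [ht, ← Real.log_inv]
    apply Real.log_le_log (by norm_num)
    rw [le_inv_comm₀ (by norm_num) (by linarith)]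
    linarith
  have hz : ‖Complex.exp (θ * Complex.I)‖ ≤ 1 := by rw [Complex.norm_exp_ofReal_mul_I]
  have hne := ne_aux ha' hz
  have hnorm : ‖1 - (a:ℂ) * Complex.exp (θ * Complex.I)‖ ≤ 2 * (1 - a) := by
    have e : 1 - (a:ℂ) * Complex.exp (θ * Complex.I)
        = ((1 - a : ℝ) : ℂ) - (a:ℂ) * (Complex.exp (Complex.I * θ) - 1) := by
      rw [mul_comm Complex.I]; push_cast; ring
    rw [e]
    refine (norm_sub_le _ _).trans ?_
    rw [norm_mul, Complex.norm_real, Complex.norm_real, Real.norm_of_nonneg (by linarith),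
      Real.norm_of_nonneg (by linarith)]
    have := Real.norm_exp_I_mul_ofReal_sub_one_le (x := θ)
    rw [Real.norm_of_nonneg hθ.1] at this
    nlinarith [hθ.2, hθ.1]
  have hlog : t - Real.log 2 ≤ ‖Complex.log (1 / (1 - (a:ℂ) * Complex.exp (θ * Complex.I)))‖ := by
    refine le_trans ?_ (Complex.re_le_norm _)
    rw [Complex.log_re, norm_div, norm_one, one_div, Real.log_inv, ht]
    have := Real.log_le_log (norm_pos_iff.2 hne) hnorm
    rw [Real.log_mul (by norm_num) (by linarith)] at this
    linarith
  unfold beurlingFun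
  rw [norm_div, div_pow, Complex.norm_real, Real.norm_of_nonneg (Real.sqrt_nonneg _),
    Real.sq_sqrt hL.le, le_div_iff₀ hL]
  by_cases h : t - 2 * Real.log 2 ≤ 0
  · nlinarith [sq_nonneg (‖Complex.log (1 / (1 - (a:ℂ) * Complex.exp (θ * Complex.I)))‖)]
  · push Not at h
    have h3 : (t - Real.log 2)^2 ≤ ‖Complex.log (1 / (1 - (a:ℂ) * Complex.exp (θ * Complex.I)))‖^2 :=
      pow_le_pow_left₀ (by linarith) hlog 2
    nlinarith

theorem part2 (α : ℝ) (hα : 1 < α) :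
      Tendsto (fun a : ℝ => ∫ θ in (0 : ℝ)..(2 * π),
          Real.exp (α * ‖beurlingFun a (Complex.exp (θ * Complex.I))‖ ^ 2))
        (nhdsWithin 1 (Iio 1)) atTop := by
  have hlim : Tendsto (fun a : ℝ => Real.exp ((α - 1) * (-Real.log (1 - a)) - 2 * α * Real.log 2))
      (nhdsWithin 1 (Iio 1)) atTop := by
    apply Real.tendsto_exp_atTop.comp
    apply tendsto_atTop_add_const_right
    apply Tendsto.const_mul_atTop (by linarith)
    apply tendsto_neg_atBot_atTop.comp
    apply Real.tendsto_log_nhdsGT_zero.comp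
    apply tendsto_nhdsWithin_iff.2
    constructor
    · have : Continuous (fun a : ℝ => 1 - a) := by fun_prop
      have := this.tendsto 1
      simp only [sub_self] at this
      exact this.mono_left nhdsWithin_le_nhds
    · filter_upwards [self_mem_nhdsWithin] with a ha
      simpa using ha
  refine tendsto_atTop_mono' _ ?_ hlim
  filter_upwards [Ioo_mem_nhdsLT (show (1/2:ℝ) < 1 by norm_num)] with a ha
  have ha' : a ∈ Ioo (0:ℝ) 1 := ⟨by linarith [ha.1], ha.2⟩
  have hc := cont_aux ha' α
  have h1a : 0 < 1 - a := by linarith [ha.2]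
  have h1 : ∫ θ in (0:ℝ)..(1 - a), Real.exp (α * ‖beurlingFun a (Complex.exp (θ * Complex.I))‖ ^ 2)
     ≤ ∫ θ in (0:ℝ)..(2 * π), Real.exp (α * ‖beurlingFun a (Complex.exp (θ * Complex.I))‖ ^ 2) := by
    apply intervalIntegral.integral_mono_interval le_rfl h1a.le
    · linarith [ha.1, Real.pi_gt_three]
    · exact Eventually.of_forall fun θ => (Real.exp_pos _).le
    · exact hc.intervalIntegrable _ _
  refine le_trans ?_ h1
  have h2 : ∫ θ in (0:ℝ)..(1 - a), Real.exp (α * (-Real.log (1 - a) - 2 * Real.log 2)) ≤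
     ∫ θ in (0:ℝ)..(1 - a), Real.exp (α * ‖beurlingFun a (Complex.exp (θ * Complex.I))‖ ^ 2) := by
    apply intervalIntegral.integral_mono_on h1a.le (by simp) (hc.intervalIntegrable _ _)
    intro θ hθ
    apply Real.exp_le_exp.2
    exact mul_le_mul_of_nonneg_left (pt_bound ha hθ) (by linarith)
  refine le_trans (le_of_eq ?_) h2
  rw [intervalIntegral.integral_const, smul_eq_mul, sub_zero]
  nth_rewrite 2 [← Real.exp_log h1a]
  rw [← Real.exp_add]
  congr 1
  ring

theorem inner_int {ρ : ℝ} (h : ρ ∈ Ioo (0:ℝ) 1) :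
    ∫ θ in Ioo (-π) π, (‖1 - (ρ:ℂ) * Complex.exp (θ * Complex.I)‖ ^ 2)⁻¹ = 2 * π / (1 - ρ ^ 2) := by
  have hd : DiffContOnCl ℂ (fun _ : ℂ => (1 : ℂ)) (ball 0 1) := diffContOnCl_const
  have hP := hd.circleAverage_poissonKernel_smul' (w := (ρ:ℂ)) (by
    simp [abs_of_pos h.1, h.2])
  have hpos : 0 < 1 - ρ ^ 2 := by nlinarith [h.1, h.2]
  set g : ℝ → ℝ := fun θ => (‖1 - (ρ:ℂ) * Complex.exp (θ * Complex.I)‖ ^ 2)⁻¹ with hg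
  have hper : Function.Periodic g (2 * π) := by
    intro θ
    simp only [hg]
    have : Complex.exp (((θ + 2 * π : ℝ) : ℂ) * Complex.I) = Complex.exp (θ * Complex.I) := by
      push_cast
      rw [add_mul, Complex.exp_periodic]
    rw [this]
  rw [← integral_Ioc_eq_integral_Ioo, ← intervalIntegral.integral_of_le (by linarith [Real.pi_pos])]
  have hshift := hper.intervalIntegral_add_eq (-π) 0
  rw [show -π + 2 * π = π by ring, zero_add] at hshift
  rw [hshift]
  have key : ∀ θ : ℝ, ((‖circleMap 0 1 θ - 0‖ ^ 2 - ‖(ρ:ℂ) - 0‖ ^ 2) /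
      ‖(circleMap 0 1 θ - 0) - ((ρ:ℂ) - 0)‖ ^ 2) • (1:ℂ) = (((1 - ρ ^ 2) * g θ : ℝ) : ℂ) := by
    intro θ
    have e1 : circleMap 0 1 θ = Complex.exp (θ * Complex.I) := by simp [circleMap]
    have e2 : ‖Complex.exp (θ * Complex.I) - ρ‖ = ‖1 - (ρ:ℂ) * Complex.exp (θ * Complex.I)‖ := by
      rw [← Complex.norm_conj (1 - (ρ:ℂ) * Complex.exp (θ * Complex.I))]
      have : Complex.exp (θ * Complex.I) - ρ = Complex.exp (θ * Complex.I) *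
          (starRingEnd ℂ) (1 - (ρ:ℂ) * Complex.exp (θ * Complex.I)) := by
        rw [map_sub, map_mul, map_one, Complex.conj_ofReal, ← Complex.exp_conj, map_mul,
          Complex.conj_ofReal, Complex.conj_I, mul_sub, mul_left_comm, ← Complex.exp_add]
        simp
      rw [this, norm_mul, Complex.norm_exp_ofReal_mul_I, one_mul]
    rw [e1, sub_zero, sub_zero, e2, Complex.norm_exp_ofReal_mul_I, Complex.norm_real,
      Real.norm_eq_abs, sq_abs, Complex.real_smul, mul_one, hg, div_eq_mul_inv, one_pow]
  rw [circleAverage] at hP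
  simp only [key] at hP
  rw [intervalIntegral.integral_ofReal, intervalIntegral.integral_const_mul, Complex.real_smul] at hP
  norm_cast at hP
  have := Real.pi_pos
  field_simp at hP ⊢
  linarith

theorem energy {a : ℝ} (ha : a ∈ Ioo (0:ℝ) 1) :
    (∫ z in ball (0 : ℂ) 1, (‖1 - (a:ℂ) * z‖ ^ 2)⁻¹) = π * Real.log (1 / (1 - a ^ 2)) / a ^ 2 := by
  have hne := fun (z : ℂ) hz => ne_aux ha (z := z) hz
  rw [← integral_indicator measurableSet_ball, ← Complex.integral_comp_polarCoord_symm]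
  have hn : ∀ p ∈ Icc (0:ℝ) 1 ×ˢ Icc (-π) π, ‖(p.1 : ℂ) * Complex.exp (p.2 * Complex.I)‖ = p.1 := by
    intro p hp
    rw [norm_mul, Complex.norm_exp_ofReal_mul_I, Complex.norm_real, Real.norm_of_nonneg hp.1.1, mul_one]
  have h1 : ∫ p in polarCoord.target, p.1 • (ball (0:ℂ) 1).indicator (fun z => (‖1 - (a:ℂ) * z‖ ^ 2)⁻¹)
        (Complex.polarCoord.symm p) =
      ∫ p in Ioo (0:ℝ) 1 ×ˢ Ioo (-π) π, p.1 * (‖1 - ((a * p.1 : ℝ) : ℂ) * Complex.exp (p.2 * Complex.I)‖ ^ 2)⁻¹ := by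
    rw [← integral_indicator polarCoord.open_target.measurableSet,
      ← integral_indicator (measurableSet_Ioo.prod measurableSet_Ioo)]
    congr 1
    ext p
    have e : Complex.polarCoord.symm p = (p.1 : ℂ) * Complex.exp (p.2 * Complex.I) := by
      rw [Complex.polarCoord_symm_apply, Complex.exp_mul_I]; push_cast; ring
    have hnm : ‖Complex.polarCoord.symm p‖ = |p.1| := Complex.norm_polarCoord_symm p
    by_cases hp : p ∈ polarCoord.target
    · rw [indicator_of_mem hp]
      simp only [polarCoord_target, mem_prod, mem_Ioi] at hp
      rw [abs_of_pos hp.1] at hnm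
      by_cases h1 : p.1 < 1
      · rw [indicator_of_mem (by rwa [mem_ball_zero_iff, hnm]),
          indicator_of_mem (show p ∈ Ioo (0:ℝ) 1 ×ˢ Ioo (-π) π from ⟨⟨hp.1, h1⟩, hp.2⟩), e]
        push_cast
        rw [smul_eq_mul, mul_assoc]
      · rw [indicator_of_notMem (by rwa [mem_ball_zero_iff, hnm]), indicator_of_notMem (fun h => h1 h.1.2)]
        simp
    · rw [indicator_of_notMem hp, indicator_of_notMem]
      intro h
      exact hp ⟨h.1.1, h.2⟩
  rw [h1, Measure.volume_eq_prod, setIntegral_prod]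
  · have h2 : ∫ r in Ioo (0:ℝ) 1, ∫ θ in Ioo (-π) π,
        r * (‖1 - ((a * r : ℝ) : ℂ) * Complex.exp (θ * Complex.I)‖ ^ 2)⁻¹ =
        ∫ r in Ioo (0:ℝ) 1, r * (2 * π / (1 - (a * r) ^ 2)) := by
      apply setIntegral_congr_fun measurableSet_Ioo
      intro r hr
      simp only
      rw [integral_const_mul, inner_int]
      constructor
      · exact mul_pos ha.1 hr.1
      · nlinarith [ha.1, ha.2, hr.1, hr.2]
    rw [h2, ← integral_Ioc_eq_integral_Ioo, ← intervalIntegral.integral_of_le zero_le_one]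
    have hpos : ∀ r ∈ Icc (0:ℝ) 1, 0 < 1 - (a * r) ^ 2 := by
      intro r hr
      have : a * r < 1 := by nlinarith [ha.1, ha.2, hr.1, hr.2]
      nlinarith [mul_nonneg ha.1.le hr.1]
    rw [intervalIntegral.integral_eq_sub_of_hasDerivAt
      (f := fun r => - π / a ^ 2 * Real.log (1 - (a * r) ^ 2))]
    · simp [Real.log_inv]
      ring
    · intro r hr
      rw [uIcc_of_le zero_le_one] at hr
      have hp := hpos r hr
      have ha0 := ha.1.ne'
      have := ((((((hasDerivAt_id r).const_mul a).pow 2).const_sub 1).log hp.ne').const_mul (- π / a ^ 2))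
      refine HasDerivAt.congr_deriv this ?_
      change -π / a ^ 2 * (-(((2:ℕ):ℝ) * (a * r) ^ (2 - 1) * (a * 1)) / (1 - (a * r) ^ 2)) = _
      push_cast
      field_simp
    · apply ContinuousOn.intervalIntegrable
      rw [uIcc_of_le zero_le_one]
      apply ContinuousOn.mul continuousOn_id
      exact ContinuousOn.div continuousOn_const (by fun_prop) fun r hr => (hpos r hr).ne'
  · have hco : ContinuousOn (fun p : ℝ × ℝ => p.1 * (‖1 - ((a * p.1 : ℝ) : ℂ) * Complex.exp (p.2 * Complex.I)‖ ^ 2)⁻¹)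
        (Icc (0:ℝ) 1 ×ˢ Icc (-π) π) := by
      apply ContinuousOn.mul (by fun_prop)
      apply ContinuousOn.inv₀ (by fun_prop)
      intro p hp
      apply pow_ne_zero
      rw [norm_ne_zero_iff]
      push_cast
      rw [mul_assoc]
      apply hne
      rw [hn p hp]
      exact hp.1.2
    have := hco.integrableOn_compact (μ := volume) (isCompact_Icc.prod isCompact_Icc)
    exact this.mono_set (prod_mono Ioo_subset_Icc_self Ioo_subset_Icc_self)

theorem part1 (a : ℝ) (ha : a ∈ Ioo (0 : ℝ) 1) : beurlingFun a 0 = 0 ∧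
      (∫ z in ball (0 : ℂ) 1, ‖deriv (beurlingFun a) z‖ ^ 2) ≤ π := by
  refine ⟨by simp [beurlingFun], le_of_eq ?_⟩
  have hL := L_pos ha
  set L := Real.log (1 / (1 - a ^ 2)) with hLd
  have : ∫ z in ball (0 : ℂ) 1, ‖deriv (beurlingFun a) z‖ ^ 2 =
      ∫ z in ball (0 : ℂ) 1, (a ^ 2 / L) * (‖1 - (a:ℂ) * z‖ ^ 2)⁻¹ := by
    apply setIntegral_congr_fun measurableSet_ball
    intro z hz
    have hz' : ‖z‖ ≤ 1 := by simpa using (mem_ball_zero_iff.1 hz).le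
    have hne := ne_aux ha hz'
    have hd : HasDerivAt (beurlingFun a) ((a : ℂ) / (1 - a * z) / (Real.sqrt L : ℂ)) z := by
      unfold beurlingFun
      have h1 : HasDerivAt (fun z : ℂ => 1 - (a:ℂ) * z) (-(a:ℂ)) z := by
        simpa using ((hasDerivAt_id z).const_mul (a:ℂ)).const_sub 1
      have h2 : HasDerivAt (fun z : ℂ => 1 / (1 - (a:ℂ) * z)) ((a:ℂ) / (1 - a * z)^2) z := by
        simpa [Function.comp_def, Pi.inv_def] using h1.inv hne
      have h3 := (h2.clog (slit_aux ha hz')).div_const (Real.sqrt L : ℂ)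
      refine HasDerivAt.congr_deriv h3 ?_
      field_simp
    simp only [hd.deriv]
    rw [norm_div, norm_div, div_pow, div_pow, Complex.norm_real, Complex.norm_real, Real.norm_of_nonneg ha.1.le,
      Real.norm_of_nonneg (Real.sqrt_nonneg _), Real.sq_sqrt hL.le]
    field_simp
  rw [this, integral_const_mul, energy ha, ← hLd]
  have := ha.1.ne'
  field_simp

/-- sharpness of Beurling's bound: for 0 < a < 1, B_a vanishes at 0 and has
Dirichlet energy at most π, while for every α > 1 the integral ∫₀^{2π} exp(α|B_a(e^{iθ})|²) dθ
tends to ∞ as a → 1⁻. -/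
theorem beurling_sharp :
    (∀ a ∈ Ioo (0 : ℝ) 1, beurlingFun a 0 = 0 ∧
      (∫ z in ball (0 : ℂ) 1, ‖deriv (beurlingFun a) z‖ ^ 2) ≤ π) ∧
    ∀ α : ℝ, 1 < α →
      Tendsto (fun a : ℝ => ∫ θ in (0 : ℝ)..(2 * π),
          Real.exp (α * ‖beurlingFun a (Complex.exp (θ * Complex.I))‖ ^ 2))
        (nhdsWithin 1 (Iio 1)) atTop := by
  exact ⟨part1, part2⟩

end
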